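/- Let d ≥ 2. There exist a universal constant α ∈ (0,1), an integer n(d) ∈ ℕ*, and a constant C(d) > 1 such that for every integer n ≥ n(d) and every x ∈ ℝ^d with C(d)/√(2n+1) ≤ |x| ≤ α √(2n+1), one has n^{d/2 − 1}/C(d) ≤ e_d(n, x) ≤ C(d) · n^{d/2 − 1}. -/

import Mathlib

open MeasureTheory
open scoped ENNReal NNReal

/-- The `n`-th physicists' Hermite polynomial `H_n(x) = (−1)^n e^{x²} (d/dx)^n e^{−x²}`. -/
noncomputable def hermitePoly (n : ℕ) (x : ℝ) : ℝ :=
  (-1 : ℝ) ^ n * Real.exp (x ^ 2) * iteratedDeriv n (fun t => Real.exp (-t ^ 2)) x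

/-- The `n`-th (L²-normalized) Hermite function
`h_n(x) = H_n(x) e^{−x²/2} / √(n! 2^n √π)`. -/
noncomputable def hermiteFun (n : ℕ) (x : ℝ) : ℝ :=
  hermitePoly n x * Real.exp (-x ^ 2 / 2) /
    Real.sqrt ((n.factorial : ℝ) * 2 ^ n * Real.sqrt Real.pi)

/-- The spectral function of the `n`-th eigenspace of the harmonic oscillator `−Δ + |x|²`
on `ℝ^d`: `e_d(n, x) = ∑_{i₁+⋯+i_d = n} h_{i₁}(x₁)² ⋯ h_{i_d}(x_d)²`. -/
noncomputable def eSpec (d n : ℕ) (x : Fin d → ℝ) : ℝ :=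
  ∑ i ∈ Finset.Nat.antidiagonalTuple d n, ∏ k, (hermiteFun (i k) (x k)) ^ 2

set_option linter.unusedSimpArgs false

section PartOne
open PowerSeries

lemma gauss_iter (n : ℕ) : ∀ x : ℝ,
    iteratedDeriv (n + 2) (fun t : ℝ => Real.exp (-t ^ 2)) x =
      -2 * x * iteratedDeriv (n + 1) (fun t : ℝ => Real.exp (-t ^ 2)) x
        - 2 * (n + 1) * iteratedDeriv n (fun t : ℝ => Real.exp (-t ^ 2)) x := by
  have hg : ContDiff ℝ ((⊤ : ℕ∞) : WithTop ℕ∞) (fun t : ℝ => Real.exp (-t ^ 2)) := by fun_prop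
  have hd : ∀ k x, HasDerivAt (iteratedDeriv k (fun t : ℝ => Real.exp (-t ^ 2)))
      (iteratedDeriv (k + 1) (fun t : ℝ => Real.exp (-t ^ 2)) x) x := by
    intro k x
    rw [iteratedDeriv_succ]
    exact ((hg.differentiable_iteratedDeriv k (by exact_mod_cast ENat.natCast_lt_top k)) x).hasDerivAt
  have h1 : ∀ x, iteratedDeriv 1 (fun t : ℝ => Real.exp (-t ^ 2)) x
      = -2 * x * Real.exp (-x ^ 2) := by
    intro x
    rw [iteratedDeriv_one]
    have : HasDerivAt (fun t : ℝ => Real.exp (-t ^ 2)) (Real.exp (-x ^ 2) * (-(2 * x))) x := by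
      have := ((hasDerivAt_pow 2 x).neg).exp
      simpa using this
    rw [this.deriv]; ring
  induction n with
  | zero =>
    intro x
    have e : iteratedDeriv 1 (fun t : ℝ => Real.exp (-t ^ 2)) =
        fun x => -2 * x * Real.exp (-x ^ 2) := funext h1
    have a := hd 1 x
    have b : HasDerivAt (fun x : ℝ => -2 * x * iteratedDeriv 0 (fun t : ℝ => Real.exp (-t ^ 2)) x)
        (-2 * 1 * iteratedDeriv 0 (fun t : ℝ => Real.exp (-t ^ 2)) x
          + -2 * x * iteratedDeriv 1 (fun t : ℝ => Real.exp (-t ^ 2)) x) x :=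
      ((hasDerivAt_id x).const_mul (-2)).mul (hd 0 x)
    rw [e] at a
    simp only [iteratedDeriv_zero] at b
    have := a.unique b
    simp only [iteratedDeriv_zero]
    rw [this]; push_cast; ring
  | succ n ih =>
    intro x
    have e : iteratedDeriv (n + 2) (fun t : ℝ => Real.exp (-t ^ 2)) = _ := funext ih
    have a := hd (n + 2) x
    have b : HasDerivAt (fun x : ℝ => -2 * x * iteratedDeriv (n + 1) (fun t : ℝ => Real.exp (-t ^ 2)) x
        - 2 * (n + 1) * iteratedDeriv n (fun t : ℝ => Real.exp (-t ^ 2)) x)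
        (-2 * 1 * iteratedDeriv (n + 1) (fun t : ℝ => Real.exp (-t ^ 2)) x
          + -2 * x * iteratedDeriv (n + 2) (fun t : ℝ => Real.exp (-t ^ 2)) x
          - 2 * (n + 1) * iteratedDeriv (n + 1) (fun t : ℝ => Real.exp (-t ^ 2)) x) x :=
      (((hasDerivAt_id x).const_mul (-2)).mul (hd (n + 1) x)).sub ((hd n x).const_mul _)
    rw [e] at a
    have := a.unique b
    rw [show n + 1 + 2 = n + 2 + 1 by ring, this]
    push_cast; ring

lemma hermitePoly_rec (n : ℕ) (x : ℝ) : hermitePoly (n + 2) x =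
    2 * x * hermitePoly (n + 1) x - 2 * (n + 1) * hermitePoly n x := by
  unfold hermitePoly
  rw [gauss_iter]; ring

lemma hermitePoly_zero (x : ℝ) : hermitePoly 0 x = 1 := by
  simp [hermitePoly, ← Real.exp_add]

lemma hermitePoly_one (x : ℝ) : hermitePoly 1 x = 2 * x := by
  unfold hermitePoly
  have : HasDerivAt (fun t : ℝ => Real.exp (-t ^ 2)) (Real.exp (-x ^ 2) * (-(2 * x))) x := by
    have := ((hasDerivAt_pow 2 x).neg).exp
    simpa using this
  rw [iteratedDeriv_one, this.deriv]
  have : Real.exp (x ^ 2) * Real.exp (-x ^ 2) = 1 := by rw [← Real.exp_add]; simp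
  linear_combination (2 * x) * this

/-- weight -/
noncomputable def hw (n : ℕ) (x : ℝ) : ℝ :=
  Real.exp (-x ^ 2) / ((n.factorial : ℝ) * 2 ^ n * Real.sqrt Real.pi)

lemma hermiteFun_sq (n : ℕ) (x : ℝ) : hermiteFun n x ^ 2 = hermitePoly n x ^ 2 * hw n x := by
  unfold hermiteFun hw
  rw [div_pow, Real.sq_sqrt (by positivity), mul_pow, ← Real.exp_nat_mul]
  rw [mul_div_assoc]
  congr 3; push_cast; ring

lemma hw_succ (n : ℕ) (x : ℝ) : hw n x = 2 * (n + 1) * hw (n + 1) x := by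
  unfold hw
  have : Real.sqrt Real.pi ≠ 0 := (Real.sqrt_pos.2 Real.pi_pos).ne'
  rw [Nat.factorial_succ]; push_cast
  field_simp; ring

lemma hsq_zero (x : ℝ) : hermiteFun 0 x ^ 2 = Real.exp (-x ^ 2) * (Real.sqrt Real.pi)⁻¹ := by
  rw [hermiteFun_sq, hermitePoly_zero]; simp [hw, div_eq_mul_inv]

lemma hsq_one (x : ℝ) : hermiteFun 1 x ^ 2 = 2 * x ^ 2 * hermiteFun 0 x ^ 2 := by
  rw [hermiteFun_sq, hermiteFun_sq, hermitePoly_zero, hermitePoly_one, hw_succ 0 x]; push_cast; ring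

lemma hsq_two (x : ℝ) : 2 * hermiteFun 2 x ^ 2 =
    (2 * x ^ 2 - 1) * hermiteFun 1 x ^ 2 + (1 - 2 * x ^ 2) * hermiteFun 0 x ^ 2 := by
  rw [hermiteFun_sq, hermiteFun_sq, hermiteFun_sq, hermitePoly_rec 0, hermitePoly_zero,
    hermitePoly_one, hw_succ 0 x, hw_succ 1 x]; push_cast; ring

lemma hsq_rec (n : ℕ) (x : ℝ) :
    (n + 3) * hermiteFun (n + 3) x ^ 2 + (n + 2) * hermiteFun (n + 2) x ^ 2
      - (n + 1) * hermiteFun (n + 1) x ^ 2 - n * hermiteFun n x ^ 2 =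
    2 * x ^ 2 * hermiteFun (n + 2) x ^ 2 + (1 - 2 * x ^ 2) * hermiteFun (n + 1) x ^ 2
      + hermiteFun n x ^ 2 := by
  rw [hermiteFun_sq, hermiteFun_sq, hermiteFun_sq, hermiteFun_sq, hermitePoly_rec (n + 1),
    hermitePoly_rec n, hw_succ n x, hw_succ (n + 1) x, hw_succ (n + 2) x]
  push_cast; ring

noncomputable def Mser (x : ℝ) : ℝ⟦X⟧ := PowerSeries.mk fun n => hermiteFun n x ^ 2

/-- `(1-r)(1+r)^2` -/
noncomputable def Dser : ℝ⟦X⟧ := (1 - X) * (1 + X) ^ 2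

/-- coefficient of the differential equation -/
noncomputable def Aser (d s : ℝ) : ℝ⟦X⟧ := C d * (X * (1 + X)) + C (2 * s) * (1 - X)

lemma Mser_ode (x : ℝ) : Dser * d⁄dX ℝ (Mser x) = Aser 1 (x ^ 2) * Mser x := by
  have e1 : Dser * d⁄dX ℝ (Mser x) = d⁄dX ℝ (Mser x) + X * d⁄dX ℝ (Mser x)
     - X * (X * d⁄dX ℝ (Mser x)) - X * (X * (X * d⁄dX ℝ (Mser x))) := by
    unfold Dser; ring
  have e2 : Aser 1 (x ^ 2) * Mser x = X * Mser x + X * (X * Mser x) + C (2 * x ^ 2) * Mser x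
     - C (2 * x ^ 2) * (X * Mser x) := by
    unfold Aser; simp only [map_one]; ring
  rw [e1, e2]
  ext n
  rcases n with _ | _ | n
  · have := hsq_one x
    simp only [map_add, map_sub, coeff_zero_X_mul, coeff_C_mul, Mser,
      coeff_derivative, coeff_mk]
    norm_num
    linarith
  · have := hsq_two x
    simp only [map_add, map_sub, coeff_succ_X_mul, coeff_zero_X_mul, coeff_C_mul, Mser,
      coeff_derivative, coeff_mk]
    norm_num
    linarith
  · have h := hsq_rec n x
    rcases n with _ | n
    · simp only [map_add, map_sub, coeff_succ_X_mul, coeff_zero_X_mul, coeff_C_mul, Mser,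
        coeff_derivative, coeff_mk]
      norm_num at h ⊢
      linarith
    · simp only [map_add, map_sub, coeff_succ_X_mul, coeff_zero_X_mul, coeff_C_mul, Mser,
        coeff_derivative, coeff_mk]
      push_cast at h ⊢
      linear_combination h

lemma ode_mul (d e s t : ℝ) (G H : ℝ⟦X⟧) (hG : Dser * d⁄dX ℝ G = Aser d s * G)
    (hH : Dser * d⁄dX ℝ H = Aser e t * H) :
    Dser * d⁄dX ℝ (G * H) = Aser (d + e) (s + t) * (G * H) := by
  rw [Derivation.leibniz, smul_eq_mul, smul_eq_mul]
  have : Aser (d + e) (s + t) = Aser d s + Aser e t := by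
    unfold Aser; simp only [mul_add, map_add]; ring
  rw [this]
  linear_combination G * hH + H * hG

lemma ode_unique (A G H : ℝ⟦X⟧) (hG : Dser * d⁄dX ℝ G = A * G)
    (hH : Dser * d⁄dX ℝ H = A * H) (h0 : constantCoeff H ≠ 0)
    (h : constantCoeff G = constantCoeff H) : G = H := by
  have hHi : H⁻¹ * H = 1 := PowerSeries.inv_mul_cancel _ h0
  set K := G * H⁻¹ with hK
  have hKH : K * H = G := by rw [hK, mul_assoc, hHi, mul_one]
  have h1 : Dser * d⁄dX ℝ (K * H) = A * (K * H) := by rw [hKH]; exact hG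
  rw [Derivation.leibniz, smul_eq_mul, smul_eq_mul] at h1
  have h2 : (Dser * H) * d⁄dX ℝ K = 0 := by linear_combination h1 - K * hH
  have hD : Dser * H ≠ 0 := by
    intro h3
    have := congrArg constantCoeff h3
    simp [Dser] at this
    exact h0 this
  have h4 : d⁄dX ℝ K = 0 := (mul_eq_zero.1 h2).resolve_left hD
  have h5 : K = 1 := by
    apply derivative.ext
    · rw [h4, derivative_one]
    · have := congrArg constantCoeff hKH
      rw [map_mul, h] at this
      rw [map_one]
      exact mul_right_cancel₀ h0 (by rw [this, one_mul])
  rw [← hKH, h5, one_mul]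

lemma prod_ode (d : ℕ) (x : Fin d → ℝ) :
    Dser * d⁄dX ℝ (∏ k, Mser (x k)) = Aser d (∑ k, x k ^ 2) * ∏ k, Mser (x k) := by
  induction d with
  | zero => simp [Aser]
  | succ d ih =>
    rw [Fin.prod_univ_succ, Fin.sum_univ_succ]
    have := ode_mul 1 d (x 0 ^ 2) _ _ _ (Mser_ode (x 0)) (ih (fun k => x k.succ))
    rw [this]; push_cast; rw [add_comm (1 : ℝ)]

lemma eSpec_coeff (d n : ℕ) (x : Fin d → ℝ) : eSpec d n x = coeff n (∏ k, Mser (x k)) := by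
  rw [coeff_prod]
  unfold eSpec
  symm
  refine Finset.sum_bij (fun l _ => ⇑l) ?_ ?_ ?_ ?_
  · intro l hl
    rw [Finset.mem_finsuppAntidiag] at hl
    rw [Finset.Nat.mem_antidiagonalTuple]
    exact hl.1
  · intro a _ b _ h
    exact DFunLike.coe_injective h
  · intro b hb
    rw [Finset.Nat.mem_antidiagonalTuple] at hb
    refine ⟨Finsupp.equivFunOnFinite.symm b, ?_, ?_⟩
    · rw [Finset.mem_finsuppAntidiag]
      refine ⟨?_, Finset.subset_univ _⟩
      simpa using hb
    · simp
  · intro l _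
    simp [Mser]

/-- alternating Laguerre functions `(-1)^k e^{-s} L_k(2s)` -/
noncomputable def lf : ℕ → ℝ → ℝ
  | 0, s => Real.exp (-s)
  | 1, s => (2 * s - 1) * Real.exp (-s)
  | (k + 2), s => ((2 * s - 3 - 2 * k) * lf (k + 1) s - (k + 1) * lf k s) / (k + 2)

lemma lf_zero (s : ℝ) : lf 0 s = Real.exp (-s) := by simp [lf]
lemma lf_one (s : ℝ) : lf 1 s = (2 * s - 1) * Real.exp (-s) := by simp [lf]
lemma lf_rec (k : ℕ) (s : ℝ) :
    (k + 2) * lf (k + 2) s = (2 * s - 3 - 2 * k) * lf (k + 1) s - (k + 1) * lf k s := by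
  rw [lf]; field_simp

noncomputable def FF (n : ℕ) (s : ℝ) : ℝ := ∑ k ∈ Finset.range (n + 1), lf k s

lemma FF_zero (s : ℝ) : FF 0 s = Real.exp (-s) := by simp [FF, lf_zero]
lemma FF_succ (n : ℕ) (s : ℝ) : FF (n + 1) s = FF n s + lf (n + 1) s := by
  unfold FF; rw [Finset.sum_range_succ]

noncomputable def Fser (s : ℝ) : ℝ⟦X⟧ := PowerSeries.mk fun n => FF n s

noncomputable def Qser (s : ℝ) : ℝ⟦X⟧ := PowerSeries.mk fun n => lf n s

lemma Fser_mul (s : ℝ) : (1 - X) * Fser s = Qser s := by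
  rw [sub_mul, one_mul]
  ext n
  rcases n with _ | n
  · simp [Fser, Qser, FF]
  · rw [map_sub, coeff_succ_X_mul]; simp [Fser, Qser, FF_succ]

lemma Qser_ode (s : ℝ) : (1 + X) ^ 2 * d⁄dX ℝ (Qser s) = (C (2 * s - 1) - X) * Qser s := by
  have e1 : (1 + X) ^ 2 * d⁄dX ℝ (Qser s) = d⁄dX ℝ (Qser s) + C 2 * (X * d⁄dX ℝ (Qser s))
     + X * (X * d⁄dX ℝ (Qser s)) := by
    have : (C 2 : ℝ⟦X⟧) = 2 := map_ofNat C 2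
    rw [this]; ring
  obtain ⟨c, hc⟩ : ∃ c, c = 2 * s - 1 := ⟨_, rfl⟩
  rw [e1, sub_mul, ← hc]
  ext n
  rcases n with _ | _ | n
  · simp only [map_add, map_sub, coeff_zero_X_mul, coeff_C_mul, Qser,
        coeff_derivative, coeff_mk]
    rw [hc]
    norm_num [lf_zero, lf_one]
  · have := lf_rec 0 s
    simp only [map_add, map_sub, coeff_succ_X_mul, coeff_zero_X_mul, coeff_C_mul, Qser,
        coeff_derivative, coeff_mk]
    rw [hc]
    norm_num at this ⊢
    linarith
  · have := lf_rec (n + 1) s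
    simp only [map_add, map_sub, coeff_succ_X_mul, coeff_zero_X_mul, coeff_C_mul, Qser,
        coeff_derivative, coeff_mk]
    rw [hc]
    push_cast at this ⊢
    linear_combination this

lemma Fser_ode (s : ℝ) : Dser * d⁄dX ℝ (Fser s) = Aser 2 s * Fser s := by
  have h := Qser_ode s
  rw [← Fser_mul, Derivation.leibniz, smul_eq_mul, smul_eq_mul, map_sub, derivative_one,
    derivative_X] at h
  have e : (C (2 * s - 1) : ℝ⟦X⟧) = C (2 * s) - 1 := by rw [map_sub, map_one]
  have e2 : (C 2 : ℝ⟦X⟧) = 2 := map_ofNat C 2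
  rw [e] at h
  unfold Dser Aser
  rw [e2]
  linear_combination h

/-- coefficients of `(1-r^2)^{-m/2}` -/
noncomputable def bc (m : ℕ) : ℕ → ℝ
  | 0 => 1
  | 1 => 0
  | (j + 2) => (j + m) / (j + 2) * bc m j

noncomputable def Bser (m : ℕ) : ℝ⟦X⟧ := PowerSeries.mk (bc m)

lemma Bser_ode (m : ℕ) : Dser * d⁄dX ℝ (Bser m) = Aser m 0 * Bser m := by
  have h : d⁄dX ℝ (Bser m) - X * (X * d⁄dX ℝ (Bser m)) = C (m : ℝ) * (X * Bser m) := by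
    ext n
    rcases n with _ | _ | n
    · simp only [map_sub, coeff_zero_X_mul, coeff_C_mul, Bser,
        coeff_derivative, coeff_mk, bc]
      norm_num
    · simp only [map_add, map_sub, coeff_succ_X_mul, coeff_zero_X_mul, coeff_C_mul, Bser,
        coeff_derivative, coeff_mk, bc]
      norm_num
    · simp only [map_add, map_sub, coeff_succ_X_mul, coeff_zero_X_mul, coeff_C_mul, Bser,
        coeff_derivative, coeff_mk]
      rw [show n + 1 + 1 + 1 = (n + 1) + 2 by ring, bc]
      push_cast; field_simp; ring
  unfold Dser Aser
  simp only [mul_zero, map_zero, zero_mul, add_zero]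
  linear_combination (1 + X) * h

lemma eSpec_formula (m n : ℕ) (x : Fin (m + 2) → ℝ) :
    eSpec (m + 2) n x = ((Real.sqrt Real.pi)⁻¹) ^ (m + 2) *
      ∑ p ∈ Finset.HasAntidiagonal.antidiagonal n, FF p.1 (∑ k, x k ^ 2) * bc m p.2 := by
  have hp : Real.sqrt Real.pi ≠ 0 := (Real.sqrt_pos.2 Real.pi_pos).ne'
  have key : ∏ k, Mser (x k) = C (((Real.sqrt Real.pi)⁻¹) ^ (m + 2)) *
      (Fser (∑ k, x k ^ 2) * Bser m) := by
    have h2 := ode_mul 2 m (∑ k, x k ^ 2) 0 _ _ (Fser_ode _) (Bser_ode m)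
    have hc : constantCoeff (Fser (∑ k, x k ^ 2) * Bser m) = Real.exp (-∑ k, x k ^ 2) := by
      rw [map_mul, ← coeff_zero_eq_constantCoeff_apply, ← coeff_zero_eq_constantCoeff_apply]
      simp [Fser, Bser, FF_zero, bc]
    apply ode_unique (Aser (m + 2 : ℕ) (∑ k, x k ^ 2)) _ _ (prod_ode _ x)
    · rw [add_zero] at h2
      rw [Derivation.leibniz, derivative_C, smul_zero, add_zero, smul_eq_mul]
      push_cast
      rw [add_comm (m : ℝ)]
      linear_combination (C (((Real.sqrt Real.pi)⁻¹) ^ (m + 2))) * h2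
    · rw [map_mul, hc, constantCoeff_C]
      positivity
    · rw [map_mul, hc, constantCoeff_C, map_prod]
      simp only [← coeff_zero_eq_constantCoeff_apply, Mser, coeff_mk, hsq_zero]
      rw [Finset.prod_mul_distrib, ← Real.exp_sum, Finset.sum_neg_distrib]
      simp; ring
  rw [eSpec_coeff, key, coeff_C_mul, coeff_mul]
  simp [Fser, Bser]

end PartOne

section PartTwo

lemma core_B (ν : ℝ) (P Z g : ℝ → ℝ)
    (cP : Continuous P) (cZ : Continuous Z) (cg : Continuous g)
    (hP : ∀ s, 0 < s → HasDerivAt P (Z s) s)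
    (hZ : ∀ s, 0 < s → HasDerivAt Z (-(ν / s - 1) * P s) s)
    (hg : ∀ s, P s = s * g s) (hν : 0 < ν) :
    AntitoneOn (fun s => Z s ^ 2 + ν * s * g s ^ 2 - P s ^ 2) (Set.Icc 0 ν) ∧
    (∀ s, 0 < s → Z s ^ 2 + ν * s * g s ^ 2 - P s ^ 2 = Z s ^ 2 + (ν / s - 1) * P s ^ 2) ∧
    (∀ u, 0 < u → HasDerivAt (fun s => Z s ^ 2 + (ν / s - 1) * P s ^ 2) (-(ν / u ^ 2) * P u ^ 2) u)
      := by
  have hd : ∀ u, 0 < u → HasDerivAt (fun s => Z s ^ 2 + (ν / s - 1) * P s ^ 2)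
      (-(ν / u ^ 2) * P u ^ 2) u := by
    intro u hu
    have h1 := (hZ u hu).pow 2
    have h2 := (hP u hu).pow 2
    have h3 : HasDerivAt (fun s => ν / s - 1) (-(ν / u ^ 2)) u := by
      have := ((hasDerivAt_inv hu.ne').const_mul ν).sub_const 1
      refine (this.congr_deriv ?_)
      rw [div_eq_mul_inv]; ring
    have := h1.add (h3.mul h2)
    refine this.congr_deriv ?_
    simp
    ring
  have he : ∀ s, 0 < s → Z s ^ 2 + ν * s * g s ^ 2 - P s ^ 2
      = Z s ^ 2 + (ν / s - 1) * P s ^ 2 := by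
    intro s hs
    rw [hg s]; field_simp; ring
  refine ⟨?_, he, hd⟩
  have hd' : ∀ u, 0 < u → HasDerivAt (fun s => Z s ^ 2 + ν * s * g s ^ 2 - P s ^ 2)
      (-(ν / u ^ 2) * P u ^ 2) u := by
    intro u hu
    refine (hd u hu).congr_of_eventuallyEq ?_
    filter_upwards [lt_mem_nhds hu] with s hs
    exact he s hs
  apply antitoneOn_of_deriv_nonpos (convex_Icc 0 ν)
  · fun_prop
  · intro u hu
    rw [interior_Icc] at hu
    exact (hd' u hu.1).differentiableAt.differentiableWithinAt
  · intro u hu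
    rw [interior_Icc] at hu
    rw [(hd' u hu.1).deriv]
    have : 0 ≤ ν / u ^ 2 * P u ^ 2 := by positivity
    linarith

lemma core (ν : ℝ) (P Z F g : ℝ → ℝ)
    (cP : Continuous P) (cZ : Continuous Z) (cF : Continuous F) (cg : Continuous g)
    (hP : ∀ s, 0 < s → HasDerivAt P (Z s) s)
    (hZ : ∀ s, 0 < s → HasDerivAt Z (-(ν / s - 1) * P s) s)
    (hF : ∀ s, 0 < s → HasDerivAt F (P s / s) s)
    (hg : ∀ s, P s = s * g s) (hν : 0 < ν)
    (h0 : Z 0 ^ 2 = (ν / 2) ^ 2) (hF0 : F 0 + Z 0 / ν = 1 / 2) (s : ℝ) (hs : 0 < s)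
    (hsν : s ≤ ν / 2) :
    |F s - 1 / 2| ≤ 6 / ν + 2 * |Z s| / ν ∧ |Z s| ≤ ν / 2 ∧
    (1 / ν ≤ s → Z s ^ 2 * (1 / 2 + 1 / 4 * Real.log (ν * s)) ≤ 3 / 8 * ν ^ 2) := by
  obtain ⟨hanti, he, hd⟩ := core_B ν P Z g cP cZ cg hP hZ hg hν
  have hP0 : P 0 = 0 := by rw [hg]; simp
  have hB : ∀ u, 0 < u → u ≤ ν / 2 → Z u ^ 2 + (ν / u - 1) * P u ^ 2 ≤ ν ^ 2 / 4 := by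
    intro u hu hu2
    have := hanti (a := 0) (b := u) ⟨le_rfl, hν.le⟩ ⟨hu.le, by linarith⟩ hu.le
    simp only at this
    rw [he u hu] at this
    rw [hP0, h0] at this
    nlinarith
  have hq : ∀ u, 0 < u → u ≤ ν / 2 → 2 ≤ ν / u := by
    intro u hu hu2
    rw [le_div_iff₀ hu]; linarith
  have hPb : ∀ u, 0 < u → u ≤ ν / 2 → |P u| ≤ ν / 2 := by
    intro u hu hu2
    apply abs_le_of_sq_le_sq _ (by positivity)
    nlinarith [hB u hu hu2, hq u hu hu2, sq_nonneg (P u), sq_nonneg (Z u)]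
  have hZb : ∀ u, 0 < u → u ≤ ν / 2 → |Z u| ≤ ν / 2 := by
    intro u hu hu2
    apply abs_le_of_sq_le_sq _ (by positivity)
    nlinarith [hB u hu hu2, hq u hu hu2, sq_nonneg (P u), sq_nonneg (Z u)]
  refine ⟨?_, hZb s hs hsν, ?_⟩
  · -- mean value
    have hdH : ∀ u ∈ Set.Ioo 0 s, HasDerivAt
        (fun u => F u + Z u * (ν - u)⁻¹ - P u * ((ν - u)⁻¹) ^ 2)
        (-2 * P u * ((ν - u)⁻¹) ^ 3) u := by
      intro u hu
      have hne : ν - u ≠ 0 := by have := hu.2; intro h; linarith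
      have hi : HasDerivAt (fun u => (ν - u)⁻¹) (((ν - u)⁻¹) ^ 2) u := by
        have := ((hasDerivAt_id u).const_sub ν).inv hne
        refine this.congr_deriv ?_
        simp
      have := ((hF u hu.1).add ((hZ u hu.1).mul hi)).sub ((hP u hu.1).mul (hi.pow 2))
      refine this.congr_deriv ?_
      have := hu.1.ne'
      simp
      field_simp
      ring
    obtain ⟨c, hc, hceq⟩ := exists_hasDerivAt_eq_slope
      (fun u => F u + Z u * (ν - u)⁻¹ - P u * ((ν - u)⁻¹) ^ 2)
      (fun u => -2 * P u * ((ν - u)⁻¹) ^ 3) hs (by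
        have : ContinuousOn (fun u => (ν - u)⁻¹) (Set.Icc 0 s) := by
          apply ContinuousOn.inv₀ (by fun_prop)
          intro u hu h; have := hu.2; linarith
        fun_prop) hdH
    have hi : ∀ u, u ≤ ν / 2 → 0 ≤ (ν - u)⁻¹ ∧ (ν - u)⁻¹ ≤ 2 / ν := by
      intro u hu
      refine ⟨inv_nonneg.2 (by linarith), ?_⟩
      rw [inv_le_comm₀ (by linarith) (by positivity), inv_div]
      linarith
    have hcν : c ≤ ν / 2 := hc.2.le.trans hsν
    obtain ⟨i1, i2⟩ := hi c hcν
    obtain ⟨j1, j2⟩ := hi s hsν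
    have b1 : |(-2 * P c * ((ν - c)⁻¹) ^ 3) * s| ≤ 4 / ν := by
      rw [abs_mul, abs_mul, abs_mul, abs_of_pos hs, abs_of_nonneg (pow_nonneg i1 3)]
      calc |(-2 : ℝ)| * |P c| * ((ν - c)⁻¹) ^ 3 * s
          ≤ 2 * (ν / 2) * (2 / ν) ^ 3 * (ν / 2) := by
            have := hPb c hc.1 hcν
            rw [abs_neg, abs_two]
            gcongr
        _ = 4 / ν := by field_simp; norm_num
    have b2 : |P s * ((ν - s)⁻¹) ^ 2| ≤ 2 / ν := by
      rw [abs_mul, abs_of_nonneg (pow_nonneg j1 2)]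
      calc |P s| * ((ν - s)⁻¹) ^ 2 ≤ (ν / 2) * (2 / ν) ^ 2 := by
            have := hPb s hs hsν
            gcongr
        _ = 2 / ν := by field_simp
    have b3 : |Z s * (ν - s)⁻¹| ≤ 2 * |Z s| / ν := by
      rw [abs_mul, abs_of_nonneg j1]
      calc |Z s| * (ν - s)⁻¹ ≤ |Z s| * (2 / ν) := by gcongr
        _ = 2 * |Z s| / ν := by ring
    have e : F s - 1 / 2 = (-2 * P c * ((ν - c)⁻¹) ^ 3) * s + P s * ((ν - s)⁻¹) ^ 2
        - Z s * (ν - s)⁻¹ := by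
      rw [hceq]
      rw [hP0]
      have : (F 0 + Z 0 * (ν - 0)⁻¹) = 1 / 2 := by rw [← hF0, sub_zero, div_eq_mul_inv]
      have hs' := hs.ne'
      rw [sub_zero s, div_mul_cancel₀ _ hs']
      linear_combination this
    rw [e]
    have t1 := abs_sub ((-2 * P c * ((ν - c)⁻¹) ^ 3) * s + P s * ((ν - s)⁻¹) ^ 2)
      (Z s * (ν - s)⁻¹)
    have t2 := abs_add_le ((-2 * P c * ((ν - c)⁻¹) ^ 3) * s) (P s * ((ν - s)⁻¹) ^ 2)
    have : 6 / ν = 4 / ν + 2 / ν := by ring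
    linarith
  · intro hs1
    have hu0 : 0 < 1 / ν := by positivity
    set k : ℝ := (Z s ^ 2 + (ν / s - 1) * P s ^ 2) / 4 with hk
    have hPZ : ∀ u, 1 / ν ≤ u → u ≤ ν / 2 →
        |P u * Z u * u⁻¹ / 2| ≤ (Z u ^ 2 + (ν / u) * P u ^ 2) / 4 := by
      intro u hu1 hu2
      have hu : 0 < u := hu0.trans_le hu1
      have h1 : (P u * u⁻¹) ^ 2 ≤ ν / u * P u ^ 2 := by
        rw [mul_pow, div_eq_mul_inv]
        have : u⁻¹ ≤ ν := by rw [inv_le_comm₀ hu hν, ← one_div]; exact hu1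
        have h3 : u⁻¹ * u⁻¹ ≤ ν * u⁻¹ := by gcongr
        nlinarith [sq_nonneg (P u)]
      rw [abs_le]
      constructor
      · nlinarith [sq_nonneg (P u * u⁻¹ + Z u)]
      · nlinarith [sq_nonneg (P u * u⁻¹ - Z u)]
    have hΘ : AntitoneOn (fun u => (Z u ^ 2 + (ν / u - 1) * P u ^ 2) - P u * Z u * u⁻¹ / 2
        + k * Real.log u) (Set.Icc (1 / ν) s) := by
      have hdT : ∀ u, 0 < u → HasDerivAt (fun u => (Z u ^ 2 + (ν / u - 1) * P u ^ 2)
          - P u * Z u * u⁻¹ / 2 + k * Real.log u)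
          (-(ν / u ^ 2) * P u ^ 2 - ((Z u * Z u + P u * (-(ν / u - 1) * P u)) * u⁻¹
            + P u * Z u * (-(u ^ 2)⁻¹)) / 2 + k * u⁻¹) u := by
        intro u hu
        exact ((hd u hu).sub ((((hP u hu).mul (hZ u hu)).mul (hasDerivAt_inv hu.ne')).div_const 2)).add
          ((Real.hasDerivAt_log hu.ne').const_mul k)
      apply antitoneOn_of_deriv_nonpos (convex_Icc _ _)
      · intro u hu
        exact (hdT u (hu0.trans_le hu.1)).continuousAt.continuousWithinAt
      · intro u hu
        rw [interior_Icc] at hu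
        exact (hdT u (hu0.trans hu.1)).differentiableAt.differentiableWithinAt
      · intro u hu
        rw [interior_Icc] at hu
        have hup := hu0.trans hu.1
        rw [(hdT u hup).deriv]
        have hku : k ≤ (Z u ^ 2 + (ν / u - 1) * P u ^ 2) / 4 := by
          have := hanti (a := u) (b := s) ⟨hup.le, by linarith [hu.2]⟩
            ⟨hs.le, by linarith⟩ hu.2.le
          simp only at this
          rw [he u hup, he s hs] at this
          rw [hk]; linarith
        have h2 := (abs_le.1 (hPZ u hu.1.le (by linarith [hu.2]))).2
        have e : -(ν / u ^ 2) * P u ^ 2 - ((Z u * Z u + P u * (-(ν / u - 1) * P u)) * u⁻¹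
            + P u * Z u * (-(u ^ 2)⁻¹)) / 2 + k * u⁻¹
            = u⁻¹ * (-(ν / u) * P u ^ 2 / 2 - Z u ^ 2 / 2 - P u ^ 2 / 2
              + P u * Z u * u⁻¹ / 2 + k) := by
          field_simp; ring
        rw [e]
        apply mul_nonpos_of_nonneg_of_nonpos (by positivity)
        nlinarith [sq_nonneg (P u)]
    have h1 := hΘ (a := 1 / ν) (b := s) ⟨le_rfl, hs1⟩ ⟨hs1, le_rfl⟩ hs1
    simp only at h1
    have hu2 : 1 / ν ≤ ν / 2 := hs1.trans hsν
    have hh : ∀ u, 1 / ν ≤ u → u ≤ ν / 2 →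
        |P u * Z u * u⁻¹ / 2| ≤ (Z u ^ 2 + (ν / u - 1) * P u ^ 2) / 2 := by
      intro u h1 h2
      have := hPZ u h1 h2
      have h3 := hq u (hu0.trans_le h1) h2
      nlinarith [sq_nonneg (P u), sq_nonneg (Z u)]
    have a1 := (abs_le.1 (hh (1 / ν) le_rfl hu2)).1
    have a2 := (abs_le.1 (hh s hs1 hsν)).2
    have a3 := hB (1 / ν) hu0 hu2
    have hlog : Real.log (ν * s) = Real.log s - Real.log (1 / ν) := by
      rw [Real.log_mul hν.ne' hs.ne', one_div, Real.log_inv]; ring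
    have hl0 : 0 ≤ Real.log (ν * s) := by
      apply Real.log_nonneg
      rw [div_le_iff₀ hν] at hs1; linarith
    have hZk : Z s ^ 2 ≤ 4 * k := by
      rw [hk]
      nlinarith [hq s hs hsν, sq_nonneg (P s)]
    have : 4 * k * (1 / 2 + 1 / 4 * Real.log (ν * s)) ≤ 3 / 8 * ν ^ 2 := by
      rw [hlog]
      have : 4 * k = Z s ^ 2 + (ν / s - 1) * P s ^ 2 := by rw [hk]; ring
      nlinarith
    refine le_trans ?_ this
    gcongr

lemma lf_contDiff (k : ℕ) : ContDiff ℝ 1 (lf k) ∧ ContDiff ℝ 1 (lf (k + 1)) := by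
  induction k with
  | zero =>
    have e0 : lf 0 = fun s => Real.exp (-s) := funext lf_zero
    have e1 : lf 1 = fun s => (2 * s - 1) * Real.exp (-s) := funext lf_one
    rw [zero_add, e0, e1]
    constructor <;> fun_prop
  | succ k ih =>
    refine ⟨ih.2, ?_⟩
    have e : lf (k + 1 + 1) = fun s =>
      ((2 * s - 3 - 2 * k) * lf (k + 1) s - (k + 1) * lf k s) / (k + 2) := by
      funext s; rw [lf]
    rw [e]
    have := ih.1
    have := ih.2
    fun_prop

lemma lf_hasDeriv (k : ℕ) (s : ℝ) : HasDerivAt (lf k) (deriv (lf k) s) s :=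
  (((lf_contDiff k).1.differentiable (by norm_num)) s).hasDerivAt

lemma lf_deriv (k : ℕ) (s : ℝ) :
    s * deriv (lf k) s = (s - 1 - k) * lf k s - (k + 1) * lf (k + 1) s ∧
    s * deriv (lf (k + 1)) s = (k + 1 - s) * lf (k + 1) s + (k + 1) * lf k s := by
  induction k with
  | zero =>
    have e0 : lf 0 = fun s => Real.exp (-s) := funext lf_zero
    have e1 : lf 1 = fun s => (2 * s - 1) * Real.exp (-s) := funext lf_one
    have h0 : HasDerivAt (fun s => Real.exp (-s)) (-Real.exp (-s)) s := by
      have := (hasDerivAt_id s).neg.exp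
      simpa using this
    have h1 : HasDerivAt (fun s => (2 * s - 1) * Real.exp (-s))
      (2 * 1 * Real.exp (-s) + (2 * s - 1) * (-Real.exp (-s))) s :=
      (((hasDerivAt_id s).const_mul 2).sub_const 1).mul h0
    rw [zero_add, e0, e1, h0.deriv, h1.deriv]
    push_cast
    constructor <;> ring
  | succ k ih =>
    obtain ⟨hA, hC⟩ := ih
    have r := lf_rec k s
    refine ⟨?_, ?_⟩
    · push_cast
      rw [show k + 1 + 1 = k + 2 by ring]
      linear_combination hC + r
    · have hd : HasDerivAt (fun s => (k + 2) * lf (k + 2) s) ((k + 2) * deriv (lf (k + 2)) s) s :=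
        (lf_hasDeriv (k + 2) s).const_mul _
      have hd2 : HasDerivAt (fun s => (2 * s - 3 - 2 * k) * lf (k + 1) s - (k + 1) * lf k s)
          (2 * 1 * lf (k + 1) s + (2 * s - 3 - 2 * k) * deriv (lf (k + 1)) s
            - (k + 1) * deriv (lf k) s) s :=
        (((((hasDerivAt_id s).const_mul 2).sub_const 3).sub_const _).mul (lf_hasDeriv (k + 1) s)).sub
          ((lf_hasDeriv k s).const_mul _)
      have e : (fun s => (k + 2) * lf (k + 2) s) =
        (fun s => (2 * s - 3 - 2 * k) * lf (k + 1) s - (k + 1) * lf k s) := funext (lf_rec k)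
      rw [e] at hd
      have h := hd.unique hd2
      have hk : (k : ℝ) + 2 ≠ 0 := by positivity
      apply mul_left_cancel₀ hk
      push_cast
      rw [show k + 1 + 1 = k + 2 by ring]
      linear_combination s * h + (2 * s - 3 - 2 * k) * hC - (k + 1) * hA - (k + 2 - s) * r

lemma lf_at_zero (k : ℕ) : lf k 0 = (-1) ^ k ∧ lf (k + 1) 0 = (-1) ^ (k + 1) := by
  induction k with
  | zero => simp [lf_zero, lf_one]
  | succ k ih =>
    refine ⟨ih.2, ?_⟩
    have r := lf_rec k 0
    rw [ih.1, ih.2] at r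
    have hk : (k : ℝ) + 2 ≠ 0 := by positivity
    apply mul_left_cancel₀ hk
    rw [show k + 1 + 1 = k + 2 by ring, r]
    ring

lemma FF_at_zero (n : ℕ) : FF n 0 = (1 + (-1) ^ n) / 2 := by
  induction n with
  | zero => simp [FF_zero]
  | succ n ih => rw [FF_succ, ih, (lf_at_zero n).2]; ring

lemma FF_contDiff (n : ℕ) : ContDiff ℝ 1 (FF n) := by
  unfold FF
  exact ContDiff.sum fun k _ => (lf_contDiff k).1

lemma FF_hasDeriv (n : ℕ) (s : ℝ) : HasDerivAt (FF n) (deriv (FF n) s) s :=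
  (((FF_contDiff n).differentiable (by norm_num)) s).hasDerivAt

lemma FF_deriv (n : ℕ) (s : ℝ) :
    s * deriv (FF n) s = -((n + 1) / 2) * (lf n s + lf (n + 1) s) := by
  induction n with
  | zero =>
    have : FF 0 = lf 0 := by funext s; rw [FF_zero, lf_zero]
    rw [this, (lf_deriv 0 s).1, lf_zero, zero_add, lf_one]; push_cast; ring
  | succ n ih =>
    have e : FF (n + 1) = fun s => FF n s + lf (n + 1) s := funext (FF_succ n)
    have : deriv (FF (n + 1)) s = deriv (FF n) s + deriv (lf (n + 1)) s := by
      rw [e]; exact ((FF_hasDeriv n s).add (lf_hasDeriv (n + 1) s)).deriv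
    rw [this, mul_add, ih, (lf_deriv n s).2]
    have r := lf_rec n s
    rw [show n + 1 + 1 = n + 2 by ring]
    push_cast
    linear_combination (1 / 2 : ℝ) * r

lemma FF_core (n : ℕ) (s : ℝ) (hs : 0 < s) (hsν : s ≤ n + 1) :
    ∃ z : ℝ, |FF n s - 1 / 2| ≤ 6 / (2 * n + 2) + 2 * |z| / (2 * n + 2) ∧ |z| ≤ n + 1 ∧
      (1 / (2 * n + 2) ≤ s → z ^ 2 * (1 / 2 + 1 / 4 * Real.log ((2 * n + 2) * s))
        ≤ 3 / 8 * (2 * n + 2) ^ 2) := by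
  have hn : (0 : ℝ) < n + 1 := by positivity
  have cl : ∀ k, Continuous (lf k) := fun k => (lf_contDiff k).1.continuous
  have h := core (2 * n + 2) (fun s => -((n + 1) / 2) * (lf n s + lf (n + 1) s))
    (fun s => -((n + 1) / 2) * (lf n s - lf (n + 1) s)) (FF n) (deriv (FF n))
    (by have := cl n; have := cl (n + 1); fun_prop)
    (by have := cl n; have := cl (n + 1); fun_prop)
    (FF_contDiff n).continuous ((FF_contDiff n).continuous_deriv (by norm_num))
    (by
      intro s hs
      refine (((lf_hasDeriv n s).add (lf_hasDeriv (n + 1) s)).const_mul _).congr_deriv ?_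
      congr 1
      apply mul_left_cancel₀ hs.ne'
      linear_combination (lf_deriv n s).1 + (lf_deriv n s).2)
    (by
      intro s hs
      refine (((lf_hasDeriv n s).sub (lf_hasDeriv (n + 1) s)).const_mul _).congr_deriv ?_
      apply mul_left_cancel₀ hs.ne'
      have e : s * (-((2 * n + 2) / s - 1) * (-((n + 1) / 2) * (lf n s + lf (n + 1) s)))
        = (s - (2 * n + 2)) * (-((n + 1) / 2) * (lf n s + lf (n + 1) s)) := by
        field_simp; ring
      rw [e]
      linear_combination (-((n + 1 : ℝ) / 2)) * ((lf_deriv n s).1 - (lf_deriv n s).2))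
    (by
      intro s hs
      have := FF_hasDeriv n s
      refine this.congr_deriv ?_
      rw [eq_div_iff hs.ne', mul_comm]
      exact FF_deriv n s)
    (fun s => (FF_deriv n s).symm) (by positivity)
    (by
      rw [(lf_at_zero n).1, (lf_at_zero n).2]
      have : ((-1 : ℝ) ^ n) ^ 2 = 1 := by rw [← pow_mul, mul_comm, pow_mul]; simp
      rw [pow_succ]
      linear_combination (n + 1 : ℝ) ^ 2 * this)
    (by
      rw [(lf_at_zero n).1, (lf_at_zero n).2, FF_at_zero, pow_succ]
      field_simp; ring)
    s hs (by linarith)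
  refine ⟨_, h.1, ?_, h.2.2⟩
  have := h.2.1
  linarith

lemma FF_upper (n : ℕ) (s : ℝ) (hs : 0 < s) (hsν : s ≤ n + 1) : FF n s ≤ 5 := by
  obtain ⟨z, h1, h2, -⟩ := FF_core n s hs hsν
  have hn : (0 : ℝ) ≤ n := n.cast_nonneg
  have h3 : 6 / (2 * (n : ℝ) + 2) ≤ 3 := by rw [div_le_iff₀ (by positivity)]; linarith
  have h4 : 2 * |z| / (2 * (n : ℝ) + 2) ≤ 1 := by rw [div_le_iff₀ (by positivity)]; linarith
  have := (abs_le.1 h1).2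
  linarith

lemma FF_lower (n : ℕ) (s : ℝ) (hn : 50 ≤ n) (hsν : s ≤ n + 1)
    (hC : Real.exp 400 ≤ (2 * n + 2) * s) : 1 / 4 ≤ FF n s := by
  have hn' : (50 : ℝ) ≤ n := by exact_mod_cast hn
  have hν : (0 : ℝ) < 2 * n + 2 := by positivity
  have h1e : 1 ≤ Real.exp 400 := Real.one_le_exp (by norm_num)
  have hs : 0 < s := by
    by_contra h
    push Not at h
    nlinarith
  obtain ⟨z, h1, -, h3⟩ := FF_core n s hs hsν
  have h3 := h3 (by rw [div_le_iff₀ hν]; linarith)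
  have hlog : 400 ≤ Real.log ((2 * n + 2) * s) := by
    rw [Real.le_log_iff_exp_le (by positivity)]; exact hC
  have h4 : |z| ≤ (2 * n + 2) / 16 := by
    apply abs_le_of_sq_le_sq _ (by positivity)
    have : z ^ 2 * 100 ≤ z ^ 2 * (1 / 2 + 1 / 4 * Real.log ((2 * n + 2) * s)) := by
      gcongr; linarith
    nlinarith
  have h5 : 6 / (2 * (n : ℝ) + 2) ≤ 1 / 8 := by rw [div_le_iff₀ (by positivity)]; linarith
  have h6 : 2 * |z| / (2 * (n : ℝ) + 2) ≤ 1 / 8 := by rw [div_le_iff₀ (by positivity)]; linarith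
  have := (abs_le.1 h1).1
  linarith

lemma FF_nonneg (n : ℕ) (s : ℝ) (hs : 0 ≤ s) : 0 ≤ FF n s := by
  have h := eSpec_formula 0 n ![Real.sqrt s, 0]
  have h0 : 0 ≤ eSpec (0 + 2) n ![Real.sqrt s, 0] := by
    unfold eSpec
    exact Finset.sum_nonneg fun i _ => Finset.prod_nonneg fun k _ => sq_nonneg _
  have hb : ∀ j, j ≠ 0 → bc 0 j = 0 := by
    intro j
    induction j using Nat.strong_induction_on with
    | _ j ih =>
      intro hj
      rcases j with _ | _ | j
      · exact absurd rfl hj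
      · simp [bc]
      · rw [bc]
        rcases j with _ | j
        · simp
        · rw [ih (j + 1) (by omega) (by omega), mul_zero]
  have hsum : ∑ p ∈ Finset.HasAntidiagonal.antidiagonal n, FF p.1 s * bc 0 p.2 = FF n s := by
    rw [Finset.sum_eq_single (n, 0)]
    · simp [bc]
    · rintro ⟨a, b⟩ hab hne
      rw [Finset.HasAntidiagonal.mem_antidiagonal] at hab
      have : b ≠ 0 := by
        rintro rfl
        apply hne; simp at hab; simp [hab]
      simp [hb b this]
    · simp
  have hs2 : ∑ k : Fin (0 + 2), (![Real.sqrt s, 0] : Fin 2 → ℝ) k ^ 2 = s := by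
    simp [Fin.sum_univ_two, Real.sq_sqrt hs]
  rw [hs2, hsum] at h
  rw [h] at h0
  have hp : 0 < ((Real.sqrt Real.pi)⁻¹) ^ (0 + 2) := by
    have := Real.sqrt_pos.2 Real.pi_pos
    positivity
  exact nonneg_of_mul_nonneg_right h0 hp

lemma FF_sum_deriv (n : ℕ) (s : ℝ) (hs : 0 < s) :
    HasDerivAt (fun s => 2 * ∑ i ∈ Finset.range n, FF i s + FF n s) (-FF n s) s := by
  induction n with
  | zero =>
    have e : (fun s => 2 * ∑ i ∈ Finset.range 0, FF i s + FF 0 s) = FF 0 := by funext s; simp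
    rw [e]
    refine (FF_hasDeriv 0 s).congr_deriv ?_
    apply mul_left_cancel₀ hs.ne'
    rw [FF_deriv, FF_zero, lf_zero, zero_add, lf_one]; push_cast; ring
  | succ n ih =>
    have e : (fun s => 2 * ∑ i ∈ Finset.range (n + 1), FF i s + FF (n + 1) s) =
      fun s => (2 * ∑ i ∈ Finset.range n, FF i s + FF n s) + (FF n s + FF (n + 1) s) := by
      funext s; rw [Finset.sum_range_succ]; ring
    rw [e]
    refine (ih.add ((FF_hasDeriv n s).add (FF_hasDeriv (n + 1) s))).congr_deriv ?_
    apply mul_left_cancel₀ hs.ne'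
    have h1 := FF_deriv n s
    have h2 := FF_deriv (n + 1) s
    have r := lf_rec n s
    rw [show n + 1 + 1 = n + 2 by ring] at h2
    push_cast at h2
    rw [FF_succ] at *
    linear_combination h1 + h2 - (1 / 2 : ℝ) * r

lemma FF_sum_le (n : ℕ) (s : ℝ) (hs : 0 ≤ s) : ∑ i ∈ Finset.range (n + 1), FF i s ≤ n + 2 := by
  have hanti : AntitoneOn (fun s => 2 * ∑ i ∈ Finset.range (n + 1), FF i s + FF (n + 1) s)
      (Set.Ici 0) := by
    apply antitoneOn_of_deriv_nonpos (convex_Ici 0)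
    · have : ∀ i, Continuous (FF i) := fun i => (FF_contDiff i).continuous
      fun_prop
    · intro u hu
      rw [interior_Ici] at hu
      exact (FF_sum_deriv (n + 1) u hu).differentiableAt.differentiableWithinAt
    · intro u hu
      rw [interior_Ici] at hu
      rw [(FF_sum_deriv (n + 1) u hu).deriv]
      have := FF_nonneg (n + 1) u (le_of_lt hu)
      linarith
  have h := hanti (a := 0) (b := s) (by simp) hs hs
  simp only at h
  have hb : ∀ i, FF i 0 ≤ 1 := by
    intro i
    rw [FF_at_zero]
    have : ((-1 : ℝ)) ^ i ≤ 1 := by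
      rcases neg_one_pow_eq_or ℝ i with h | h <;> rw [h] <;> norm_num
    linarith
  have h1 : ∑ i ∈ Finset.range (n + 1), FF i 0 ≤ n + 1 := by
    calc ∑ i ∈ Finset.range (n + 1), FF i 0 ≤ ∑ i ∈ Finset.range (n + 1), (1 : ℝ) :=
          Finset.sum_le_sum fun i _ => hb i
      _ = n + 1 := by simp
  have h2 := FF_nonneg (n + 1) s hs
  have h3 := hb (n + 1)
  linarith

end PartTwo

section PartThree

lemma bc_nonneg (m : ℕ) (j : ℕ) : 0 ≤ bc m j ∧ 0 ≤ bc m (j + 1) := by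
  induction j with
  | zero => simp [bc]
  | succ j ih =>
    refine ⟨ih.2, ?_⟩
    rw [bc]
    have := ih.1
    positivity

lemma bc_odd (m k : ℕ) : bc m (2 * k + 1) = 0 := by
  induction k with
  | zero => simp [bc]
  | succ k ih => rw [show 2 * (k + 1) + 1 = (2 * k + 1) + 2 by ring, bc, ih, mul_zero]

noncomputable def SS (m k : ℕ) : ℝ := ∑ j ∈ Finset.range (2 * k + 1), bc m j

lemma SS_succ' (m k : ℕ) : SS m (k + 1) = SS m k + bc m (2 * k + 2) := by
  unfold SS
  rw [show 2 * (k + 1) + 1 = 2 * k + 1 + 1 + 1 by ring, Finset.sum_range_succ,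
    Finset.sum_range_succ, bc_odd, add_zero]

lemma bc_SS (m k : ℕ) : bc m (2 * k) * (2 * k + m) = m * SS m k := by
  induction k with
  | zero => simp [SS, bc]
  | succ k ih =>
    have h : (2 * k + 2) * bc m (2 * k + 2) = m * SS m k := by
      rw [← ih, bc]; push_cast; field_simp
    rw [SS_succ', show 2 * (k + 1) = 2 * k + 2 by ring]
    push_cast
    linear_combination h

lemma SS_rec (m k : ℕ) : (k + 1) * SS m (k + 1) = SS m k * ((m : ℝ) / 2 + k + 1) := by
  have h : (2 * k + 2) * bc m (2 * k + 2) = m * SS m k := by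
    rw [← bc_SS, bc]; push_cast; field_simp
  rw [SS_succ']
  linear_combination (1 / 2 : ℝ) * h

lemma SS_mono (m : ℕ) : Monotone (SS m) := by
  apply monotone_nat_of_le_succ
  intro k
  rw [SS_succ']
  have := (bc_nonneg m (2 * k + 2)).1
  linarith

lemma SS_zero (m : ℕ) : SS m 0 = 1 := by simp [SS, bc]

lemma SS_pos (m k : ℕ) : 0 < SS m k := by
  have := SS_mono m (Nat.zero_le k)
  rw [SS_zero] at this; linarith

lemma SS_prod (m k : ℕ) : (m : ℝ) / 2 * SS m k * (k.factorial : ℝ) =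
    ∏ j ∈ Finset.range (k + 1), ((m : ℝ) / 2 + j) := by
  induction k with
  | zero => simp [SS_zero]
  | succ k ih =>
    rw [Finset.prod_range_succ, ← ih, Nat.factorial_succ]
    have := SS_rec m k
    push_cast
    linear_combination ((m : ℝ) / 2 * (k.factorial : ℝ)) * this

lemma SS_bound (m : ℕ) : ∃ c : ℝ, 0 < c ∧ ∃ C : ℝ, 0 < C ∧ ∃ K : ℕ, ∀ k, K ≤ k →
    c * (k : ℝ) ^ ((m : ℝ) / 2) ≤ SS m k ∧ SS m k ≤ C * (k : ℝ) ^ ((m : ℝ) / 2) := by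
  rcases Nat.eq_zero_or_pos m with rfl | hm
  · have h1 : ∀ k, SS 0 k = 1 := by
      intro k
      induction k with
      | zero => exact SS_zero 0
      | succ k ih =>
        have := SS_rec 0 k
        rw [ih] at this
        have hk : (k : ℝ) + 1 ≠ 0 := by positivity
        apply mul_left_cancel₀ hk
        rw [this]; push_cast; ring
    refine ⟨1, one_pos, 1, one_pos, 0, fun k _ => ?_⟩
    simp [h1]
  · have ha : (0 : ℝ) < (m : ℝ) / 2 := by positivity
    have hG := Real.Gamma_pos_of_pos ha
    have ht := Real.GammaSeq_tendsto_Gamma ((m : ℝ) / 2)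
    have h1 := ht.eventually (lt_mem_nhds (half_lt_self hG))
    have h2 := ht.eventually (gt_mem_nhds (show Real.Gamma ((m : ℝ) / 2) < 2 * Real.Gamma ((m : ℝ) / 2) by linarith))
    obtain ⟨K, hK⟩ := Filter.eventually_atTop.1 (h1.and h2)
    set a : ℝ := (m : ℝ) / 2 with ha'
    set G := Real.Gamma a with hG'
    refine ⟨1 / (a * (2 * G)), by positivity, 1 / (a * (G / 2)), by positivity, K, fun k hk => ?_⟩
    obtain ⟨g1, g2⟩ := hK k hk
    have hS := SS_pos m k
    have e : a * SS m k * Real.GammaSeq a k = (k : ℝ) ^ a := by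
      unfold Real.GammaSeq
      have hp := SS_prod m k
      rw [← ha'] at hp
      rw [← hp]
      have : (k.factorial : ℝ) ≠ 0 := by positivity
      field_simp
    rw [← e]
    constructor
    · rw [div_mul_eq_mul_div, one_mul, div_le_iff₀ (by positivity)]
      calc a * SS m k * Real.GammaSeq a k ≤ a * SS m k * (2 * G) := by gcongr
        _ = _ := by ring
    · rw [div_mul_eq_mul_div, one_mul, le_div_iff₀ (by positivity)]
      calc SS m k * (a * (G / 2)) = a * SS m k * (G / 2) := by ring
        _ ≤ _ := by gcongr

lemma sum_bc_le (m n : ℕ) : ∑ j ∈ Finset.range (n + 1), bc m j ≤ SS m (n / 2) := by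
  rcases Nat.even_or_odd' n with ⟨k, rfl | rfl⟩
  · rw [Nat.mul_div_cancel_left _ (by norm_num)]; rfl
  · rw [Finset.sum_range_succ, bc_odd, add_zero, show (2 * k + 1) / 2 = k by omega]; rfl

lemma bc_le (m n j : ℕ) (hj : j ≤ n) : j * bc m j ≤ m * SS m (n / 2) := by
  have h0 : 0 ≤ m * SS m (n / 2) := mul_nonneg (Nat.cast_nonneg _) (SS_pos _ _).le
  rcases Nat.even_or_odd' j with ⟨k, rfl | rfl⟩
  · have h1 := bc_SS m k
    have h2 : (m : ℝ) * SS m k ≤ m * SS m (n / 2) := by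
      apply mul_le_mul_of_nonneg_left (SS_mono m (by omega)) (Nat.cast_nonneg _)
    have h3 : 0 ≤ bc m (2 * k) * m := mul_nonneg (bc_nonneg m _).1 (Nat.cast_nonneg _)
    push_cast
    linarith
  · rw [bc_odd, mul_zero]; exact h0

lemma sum_rewrite (m n : ℕ) (s : ℝ) :
    ∑ p ∈ Finset.HasAntidiagonal.antidiagonal n, FF p.1 s * bc m p.2 =
      ∑ j ∈ Finset.range (n + 1), FF (n - j) s * bc m j := by
  rw [← Finset.Nat.sum_antidiagonal_swap]
  exact Finset.Nat.sum_antidiagonal_eq_sum_range_succ (fun i j => FF j s * bc m i) n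

lemma main_lower (m n : ℕ) (s : ℝ) (hn : 100 ≤ n) (hs0 : 0 ≤ s) (hs : s ≤ (2 * n + 1) / 4)
    (hC : 2 * Real.exp 400 ≤ (2 * n + 1) * s) :
    1 / 4 * SS m (n / 4) ≤ ∑ j ∈ Finset.range (n + 1), FF (n - j) s * bc m j := by
  unfold SS
  rw [Finset.mul_sum]
  calc ∑ j ∈ Finset.range (2 * (n / 4) + 1), 1 / 4 * bc m j
      ≤ ∑ j ∈ Finset.range (2 * (n / 4) + 1), FF (n - j) s * bc m j := by
        apply Finset.sum_le_sum
        intro j hj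
        rw [Finset.mem_range] at hj
        apply mul_le_mul_of_nonneg_right _ (bc_nonneg m j).1
        have hi : (n : ℝ) ≤ 2 * ((n - j : ℕ) : ℝ) := by
          have : n ≤ 2 * (n - j) := by omega
          exact_mod_cast this
        apply FF_lower (n - j) s (by omega)
        · linarith
        · nlinarith
    _ ≤ _ := by
        apply Finset.sum_le_sum_of_subset_of_nonneg
        · intro j hj
          rw [Finset.mem_range] at *
          omega
        · intro j _ _
          exact mul_nonneg (FF_nonneg _ _ hs0) (bc_nonneg m j).1

lemma main_upper (m n : ℕ) (s : ℝ) (hn : 1 ≤ n) (hs0 : 0 < s) (hs : s ≤ (2 * n + 1) / 4) :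
    ∑ j ∈ Finset.range (n + 1), FF (n - j) s * bc m j ≤ (5 + 6 * m) * SS m (n / 2) := by
  have hn' : (1 : ℝ) ≤ n := by exact_mod_cast hn
  have hS := SS_pos m (n / 2)
  have hterm : ∀ j ∈ Finset.range (n + 1), FF (n - j) s * bc m j ≤
      5 * bc m j + (2 * m * SS m (n / 2) / n) * FF (n - j) s := by
    intro j hj
    rw [Finset.mem_range] at hj
    have hb := (bc_nonneg m j).1
    have hF := FF_nonneg (n - j) s hs0.le
    by_cases h : 2 * j ≤ n
    · have hi : (n : ℝ) ≤ 2 * ((n - j : ℕ) : ℝ) := by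
        have : n ≤ 2 * (n - j) := by omega
        exact_mod_cast this
      have h5 := FF_upper (n - j) s hs0 (by linarith)
      have : 0 ≤ (2 * m * SS m (n / 2) / n) * FF (n - j) s := by positivity
      nlinarith
    · have h1 : bc m j ≤ 2 * m * SS m (n / 2) / n := by
        rw [le_div_iff₀ (by positivity)]
        have h2 := bc_le m n j (by omega)
        have h3 : (n : ℝ) ≤ 2 * j := by
          have : n ≤ 2 * j := by omega
          exact_mod_cast this
        nlinarith
      nlinarith
  refine (Finset.sum_le_sum hterm).trans ?_
  rw [Finset.sum_add_distrib, ← Finset.mul_sum, ← Finset.mul_sum]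
  have h1 := sum_bc_le m n
  have h2 : ∑ j ∈ Finset.range (n + 1), FF (n - j) s ≤ n + 2 := by
    have := Finset.sum_range_reflect (fun j => FF j s) (n + 1)
    simp only [Nat.add_sub_cancel] at this
    rw [this]
    exact FF_sum_le n s hs0.le
  have h3 : (2 * m * SS m (n / 2) / n) * ∑ j ∈ Finset.range (n + 1), FF (n - j) s
      ≤ (2 * m * SS m (n / 2) / n) * (3 * n) := by
    gcongr
    linarith
  have h4 : (2 * m * SS m (n / 2) / n) * (3 * n) = 6 * m * SS m (n / 2) := by
    field_simp; ring
  linarith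

end PartThree

/-- Proposition 6.1, lower bound (46): for `C(d)/√(2n+1) ≤ |x| ≤ α√(2n+1)`
the spectral function of the harmonic oscillator is comparable to `n^{d/2−1}`. -/
theorem stmt10 :
    ∃ α : ℝ, 0 < α ∧ α < 1 ∧
      ∀ d : ℕ, 2 ≤ d →
        ∃ n₀ : ℕ, 1 ≤ n₀ ∧
          ∃ C : ℝ, 1 < C ∧
            ∀ n : ℕ, n₀ ≤ n → ∀ x : Fin d → ℝ,
              C / Real.sqrt (2 * n + 1) ≤ Real.sqrt (∑ k, (x k) ^ 2) →
              Real.sqrt (∑ k, (x k) ^ 2) ≤ α * Real.sqrt (2 * n + 1) →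
              ((n : ℝ) ^ ((d : ℝ) / 2 - 1) / C ≤ eSpec d n x ∧
                eSpec d n x ≤ C * (n : ℝ) ^ ((d : ℝ) / 2 - 1)) := by
  refine ⟨1 / 2, by norm_num, by norm_num, ?_⟩
  intro d hd
  obtain ⟨m, rfl⟩ : ∃ m, d = m + 2 := ⟨d - 2, by omega⟩
  obtain ⟨c, hc, C, hC, K, hK⟩ := SS_bound m
  set κ : ℝ := ((Real.sqrt Real.pi)⁻¹) ^ (m + 2) with hκ
  have hκ0 : 0 < κ := by
    have := Real.sqrt_pos.2 Real.pi_pos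
    positivity
  have h8 : (0 : ℝ) < 8 ^ ((m : ℝ) / 2) := by positivity
  have h1e : 1 ≤ Real.exp 400 := Real.one_le_exp (by norm_num)
  refine ⟨100 + 4 * K, by omega,
    2 * Real.exp 400 + κ * (5 + 6 * m) * C + 4 * 8 ^ ((m : ℝ) / 2) / (κ * c), ?_, ?_⟩
  · have : 0 ≤ κ * (5 + 6 * m) * C := by positivity
    have : 0 ≤ 4 * 8 ^ ((m : ℝ) / 2) / (κ * c) := by positivity
    linarith
  intro n hn x hx1 hx2
  set Cf : ℝ := 2 * Real.exp 400 + κ * (5 + 6 * m) * C + 4 * 8 ^ ((m : ℝ) / 2) / (κ * c) with hCf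
  have q1 : 0 ≤ κ * (5 + 6 * m) * C := by positivity
  have q2 : 0 < 4 * 8 ^ ((m : ℝ) / 2) / (κ * c) := by positivity
  have hCe : 2 * Real.exp 400 ≤ Cf := by linarith
  have hCf1 : 1 ≤ Cf := by linarith
  have hn' : (100 : ℝ) ≤ n := by
    have : 100 ≤ n := by omega
    exact_mod_cast this
  set s : ℝ := ∑ k, x k ^ 2 with hs
  have hs0 : 0 ≤ s := Finset.sum_nonneg fun k _ => sq_nonneg _
  have hr : 0 < Real.sqrt (2 * n + 1) := Real.sqrt_pos.2 (by positivity)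
  have hrs : Real.sqrt (2 * n + 1) ^ 2 = 2 * n + 1 := Real.sq_sqrt (by positivity)
  have hss : Real.sqrt s ^ 2 = s := Real.sq_sqrt hs0
  have hsle : s ≤ (2 * n + 1) / 4 := by
    have := pow_le_pow_left₀ (Real.sqrt_nonneg s) hx2 2
    rw [mul_pow, hrs, hss] at this
    linarith
  have hsge : 2 * Real.exp 400 ≤ (2 * n + 1) * s := by
    rw [div_le_iff₀ hr] at hx1
    have := pow_le_pow_left₀ (by linarith) hx1 2
    rw [mul_pow, hrs, hss] at this
    nlinarith
  have hspos : 0 < s := by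
    rcases hs0.lt_or_eq with h | h
    · exact h
    · rw [← h] at hsge; linarith
  have hexp : (((m + 2 : ℕ) : ℝ)) / 2 - 1 = (m : ℝ) / 2 := by push_cast; ring
  rw [hexp, eSpec_formula, ← hs, ← hκ, sum_rewrite]
  have hlow := main_lower m n s (by omega) hs0 hsle hsge
  have hup := main_upper m n s (by omega) hspos hsle
  have hna : 0 ≤ (n : ℝ) ^ ((m : ℝ) / 2) := by positivity
  have ha : (0 : ℝ) ≤ (m : ℝ) / 2 := by positivity
  constructor
  · have h1 := (hK (n / 4) (by omega)).1
    have h2 : ((n : ℝ) / 8) ^ ((m : ℝ) / 2) ≤ ((n / 4 : ℕ) : ℝ) ^ ((m : ℝ) / 2) := by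
      apply Real.rpow_le_rpow (by positivity) _ ha
      have : n ≤ 8 * (n / 4) := by omega
      have : (n : ℝ) ≤ 8 * ((n / 4 : ℕ) : ℝ) := by exact_mod_cast this
      linarith
    rw [Real.div_rpow (by positivity) (by norm_num)] at h2
    calc (n : ℝ) ^ ((m : ℝ) / 2) / Cf
        ≤ (n : ℝ) ^ ((m : ℝ) / 2) / (4 * 8 ^ ((m : ℝ) / 2) / (κ * c)) := by
          apply div_le_div_of_nonneg_left hna q2
          linarith
      _ = κ * (1 / 4 * (c * ((n : ℝ) ^ ((m : ℝ) / 2) / 8 ^ ((m : ℝ) / 2)))) := by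
          field_simp
      _ ≤ κ * (1 / 4 * SS m (n / 4)) := by
          have : c * ((n : ℝ) ^ ((m : ℝ) / 2) / 8 ^ ((m : ℝ) / 2)) ≤ SS m (n / 4) :=
            le_trans (by gcongr) h1
          gcongr
      _ ≤ _ := by gcongr
  · have h1 := (hK (n / 2) (by omega)).2
    have h2 : ((n / 2 : ℕ) : ℝ) ^ ((m : ℝ) / 2) ≤ (n : ℝ) ^ ((m : ℝ) / 2) := by
      apply Real.rpow_le_rpow (by positivity) _ ha
      exact_mod_cast Nat.div_le_self n 2
    calc κ * ∑ j ∈ Finset.range (n + 1), FF (n - j) s * bc m j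
        ≤ κ * ((5 + 6 * m) * (C * (n : ℝ) ^ ((m : ℝ) / 2))) := by
          have : SS m (n / 2) ≤ C * (n : ℝ) ^ ((m : ℝ) / 2) := h1.trans (by gcongr)
          have h3 : (5 + 6 * (m : ℝ)) * SS m (n / 2) ≤
            (5 + 6 * m) * (C * (n : ℝ) ^ ((m : ℝ) / 2)) := by gcongr
          exact mul_le_mul_of_nonneg_left (hup.trans h3) hκ0.le
      _ = κ * (5 + 6 * m) * C * (n : ℝ) ^ ((m : ℝ) / 2) := by ring
      _ ≤ Cf * (n : ℝ) ^ ((m : ℝ) / 2) := by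
          apply mul_le_mul_of_nonneg_right _ hna
          linarith
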